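/- For all ω > 0, the Chang–Cooper weight satisfies δ(ω) < 1/2, and for all ω < 0, δ(ω) > 1/2, where δ(ω) = 1/ω − 1/(exp(ω) − 1). -/

import Mathlib

theorem aux_pos (x : ℝ) (hx : 0 < x) : 0 < Real.exp x * (x - 2) + x + 2 := by
  have hd : ∀ y : ℝ, HasDerivAt (fun y : ℝ => Real.exp y * (y - 2) + y + 2)
      (Real.exp y * (y - 2) + Real.exp y * 1 + 1) y := fun y =>
    ((((Real.hasDerivAt_exp y).mul ((hasDerivAt_id y).sub_const 2)).add
      (hasDerivAt_id y)).add_const 2)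
  have hm : StrictMonoOn (fun y : ℝ => Real.exp y * (y - 2) + y + 2) (Set.Ici 0) := by
    apply strictMonoOn_of_deriv_pos (convex_Ici 0)
    · exact fun y _ => (hd y).continuousAt.continuousWithinAt
    · intro y hy
      rw [interior_Ici, Set.mem_Ioi] at hy
      rw [(hd y).deriv]
      have h1 := Real.add_one_lt_exp (x := -y) (by linarith)
      have h2 : Real.exp y * Real.exp (-y) = 1 := by rw [← Real.exp_add]; simp
      nlinarith [mul_lt_mul_of_pos_left h1 (Real.exp_pos y)]
  have h := hm (Set.mem_Ici.2 le_rfl) (Set.mem_Ici.2 hx.le) hx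
  norm_num at h
  exact h

theorem aux_lt (x : ℝ) (hx : 0 < x) : 1 / x - 1 / (Real.exp x - 1) < 1 / 2 := by
  have hE : 0 < Real.exp x - 1 := by linarith [Real.add_one_lt_exp hx.ne']
  rw [div_sub_div _ _ hx.ne' hE.ne', div_lt_div_iff₀ (by positivity) (by norm_num)]
  linarith [aux_pos x hx]

theorem stmt_14 :
    (∀ ω : ℝ, 0 < ω → 1 / ω - 1 / (Real.exp ω - 1) < 1 / 2) ∧
    (∀ ω : ℝ, ω < 0 → 1 / 2 < 1 / ω - 1 / (Real.exp ω - 1)) := by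
  refine ⟨aux_lt, fun w hw => ?_⟩
  have h := aux_lt (-w) (by linarith)
  have h1 : Real.exp w < 1 := Real.exp_lt_one_iff.2 hw
  have h0 := Real.exp_pos w
  have e : 1 / (Real.exp (-w) - 1) = -1 - 1 / (Real.exp w - 1) := by
    have a : Real.exp w - 1 ≠ 0 := by intro hh; linarith
    have b : 1 - Real.exp w ≠ 0 := by intro hh; linarith
    have c : Real.exp (-w) - 1 = (1 - Real.exp w) / Real.exp w := by
      rw [Real.exp_neg]; field_simp
    rw [c, one_div_div]
    field_simp
    ring
  rw [e, one_div_neg_eq_neg_one_div] at h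
  linarith
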